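/- Let (p_i)_{i≥0} be nonnegative reals with ∑_{i≥0} p_i = 1, p_0 ∈ (0,1), mean ∑_{i≥0} i·p_i = 1, and 0 < ∑_{i≥0} i(i−1)p_i < ∞; let f(s) = ∑_{i≥0} p_i s^i, f'(s) = ∑_{i≥1} i·p_i s^{i−1}, and let q be the unique solution in (1/2,1) of q = f(1−q). Suppose (r_i)_{i≥0} is a sequence of nonnegative reals such that r_0 = p_0, ∑_{i≥0} r_{2i} = q, ∑_{i≥0} r_{2i+1} = 1−q, and for all i ≥ 1: r_{2i} = f(∑_{odd j ≤ 2i−1} r_j) − f(∑_{odd j ≤ 2i−3} r_j) and r_{2i−1} = f(1−q + ∑_{even j ≥ 2i−2} r_j) − f(1−q + ∑_{even j ≥ 2i} r_j) (sums over odd resp. even indices j in the indicated ranges, an empty sum being 0). Then r_i > 0 for all i and r_i^{1/i} → f'(1−q) as i → ∞. -/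

import Mathlib

open Filter

/-- The ratio test implies the root test: if consecutive ratios of a positive sequence tend to a
positive limit, the `n`-th roots tend to the same limit. -/
theorem tendsto_rpow_one_div_of_tendsto_div {r : ℕ → ℝ} {L : ℝ} (hr : ∀ i, 0 < r i) (hL : 0 < L)
    (h : Tendsto (fun i => r (i + 1) / r i) atTop (nhds L)) :
    Tendsto (fun i : ℕ => r i ^ (1 / (i : ℝ))) atTop (nhds L) := by
  have hlog : Tendsto (fun i => Real.log (r (i + 1)) - Real.log (r i)) atTop
      (nhds (Real.log L)) := by
    refine (h.log hL.ne').congr fun i => ?_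
    rw [Real.log_div (hr _).ne' (hr _).ne']
  have hces := hlog.cesaro
  simp only [Finset.sum_range_sub (fun i => Real.log (r i))] at hces
  have hconst : Tendsto (fun i : ℕ => (i : ℝ)⁻¹ * Real.log (r 0)) atTop (nhds 0) := by
    simpa using (tendsto_inv_atTop_nhds_zero_nat (𝕜 := ℝ)).mul_const (Real.log (r 0))
  have hexp := (Real.continuous_exp.tendsto _).comp (hces.add hconst)
  rw [add_zero, Real.exp_log hL] at hexp
  refine hexp.congr fun i => ?_
  rw [Function.comp_apply, Real.rpow_def_of_pos (hr i)]
  congr 1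
  ring

theorem tendsto_atTop_of_even_of_odd {α : Type*} {u : ℕ → α} {l : Filter α}
    (he : Tendsto (fun n => u (2 * n)) atTop l)
    (ho : Tendsto (fun n => u (2 * n + 1)) atTop l) : Tendsto u atTop l := by
  intro s hs
  obtain ⟨a, ha⟩ := mem_atTop_sets.1 (he hs)
  obtain ⟨b, hb⟩ := mem_atTop_sets.1 (ho hs)
  refine mem_atTop_sets.2 ⟨2 * a + 2 * b, fun n hn => ?_⟩
  obtain ⟨k, rfl | rfl⟩ := Nat.even_or_odd' n
  · exact ha k (by omega)
  · exact hb k (by omega)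

theorem mul_pow_pred_mul_sub_le_pow_sub_pow {x y : ℝ} (hx : 0 ≤ x) (hxy : x ≤ y) (n : ℕ) :
    n * x ^ (n - 1) * (y - x) ≤ y ^ n - x ^ n := by
  rw [← geom_sum₂_mul y x n]
  refine mul_le_mul_of_nonneg_right ?_ (sub_nonneg.2 hxy)
  rw [← nsmul_eq_mul, ← Finset.card_range n, ← Finset.sum_const, Finset.card_range]
  refine Finset.sum_le_sum fun i hi => ?_
  have hi := Finset.mem_range.1 hi
  calc x ^ (n - 1) = x ^ i * x ^ (n - 1 - i) := by rw [← pow_add]; congr 1; omega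
    _ ≤ y ^ i * x ^ (n - 1 - i) := by gcongr

theorem pow_sub_pow_le_mul_pow_pred_mul_sub {x y : ℝ} (hx : 0 ≤ x) (hxy : x ≤ y) (n : ℕ) :
    y ^ n - x ^ n ≤ n * y ^ (n - 1) * (y - x) := by
  rw [← geom_sum₂_mul y x n]
  refine mul_le_mul_of_nonneg_right ?_ (sub_nonneg.2 hxy)
  rw [← nsmul_eq_mul, ← Finset.card_range n, ← Finset.sum_const, Finset.card_range]
  refine Finset.sum_le_sum fun i hi => ?_
  have hi := Finset.mem_range.1 hi
  calc y ^ i * x ^ (n - 1 - i) ≤ y ^ i * y ^ (n - 1 - i) := by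
        have := hx.trans hxy
        gcongr
    _ = y ^ (n - 1) := by rw [← pow_add]; congr 1; omega

section GeneratingFunction

variable {p : ℕ → ℝ}

theorem summable_mul_pow_of_mem_Icc (hp : ∀ i, 0 ≤ p i) (h : Summable p) {s : ℝ}
    (hs : s ∈ Set.Icc (0 : ℝ) 1) (e : ℕ → ℕ) : Summable fun i => p i * s ^ e i :=
  h.of_nonneg_of_le (fun i => mul_nonneg (hp i) (pow_nonneg hs.1 _))
    fun i => mul_le_of_le_one_right (hp i) (pow_le_one₀ hs.1 hs.2)

theorem continuousOn_tsum_mul_pow (hp : ∀ i, 0 ≤ p i) (h : Summable p) (e : ℕ → ℕ) :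
    ContinuousOn (fun s : ℝ => ∑' i, p i * s ^ e i) (Set.Icc 0 1) := by
  refine continuousOn_tsum (fun i => by fun_prop) h fun i s hs => ?_
  rw [Real.norm_of_nonneg (mul_nonneg (hp i) (pow_nonneg hs.1 _))]
  exact mul_le_of_le_one_right (hp i) (pow_le_one₀ hs.1 hs.2)

theorem strictMonoOn_tsum_mul_pow (hp : ∀ i, 0 ≤ p i) (h : Summable p) {m : ℕ} (hm : m ≠ 0)
    (hpm : 0 < p m) : StrictMonoOn (fun s : ℝ => ∑' i, p i * s ^ i) (Set.Icc 0 1) := by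
  intro x hx y hy hxy
  refine Summable.tsum_lt_tsum (i := m) (fun i => ?_) ?_
    (summable_mul_pow_of_mem_Icc hp h hx fun i => i)
    (summable_mul_pow_of_mem_Icc hp h hy fun i => i)
  · exact mul_le_mul_of_nonneg_left (pow_le_pow_left₀ hx.1 hxy.le i) (hp i)
  · exact mul_lt_mul_of_pos_left (pow_lt_pow_left₀ hxy hx.1 hm) hpm

theorem tsum_mul_pow_sub_mem_Icc (hp : ∀ i, 0 ≤ p i) (h : Summable p)
    (h' : Summable fun i : ℕ => (i : ℝ) * p i) {x y : ℝ}
    (hx : x ∈ Set.Icc (0 : ℝ) 1) (hy : y ∈ Set.Icc (0 : ℝ) 1) (hxy : x ≤ y) :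
    (∑' i, p i * y ^ i) - ∑' i, p i * x ^ i ∈
      Set.Icc ((∑' i : ℕ, (i : ℝ) * p i * x ^ (i - 1)) * (y - x))
        ((∑' i : ℕ, (i : ℝ) * p i * y ^ (i - 1)) * (y - x)) := by
  have hsx := summable_mul_pow_of_mem_Icc hp h hx fun i => i
  have hsy := summable_mul_pow_of_mem_Icc hp h hy fun i => i
  have hp' : ∀ i : ℕ, 0 ≤ (i : ℝ) * p i := fun i => mul_nonneg i.cast_nonneg (hp i)
  have hdx := summable_mul_pow_of_mem_Icc hp' h' hx fun i => i - 1
  have hdy := summable_mul_pow_of_mem_Icc hp' h' hy fun i => i - 1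
  rw [← hsy.tsum_sub hsx, ← tsum_mul_right, ← tsum_mul_right]
  constructor
  · refine (hdx.mul_right _).tsum_le_tsum (fun i => ?_) (hsy.sub hsx)
    calc (i : ℝ) * p i * x ^ (i - 1) * (y - x) = p i * (i * x ^ (i - 1) * (y - x)) := by ring
      _ ≤ p i * (y ^ i - x ^ i) :=
        mul_le_mul_of_nonneg_left (mul_pow_pred_mul_sub_le_pow_sub_pow hx.1 hxy i) (hp i)
      _ = p i * y ^ i - p i * x ^ i := by ring
  · refine (hsy.sub hsx).tsum_le_tsum (fun i => ?_) (hdy.mul_right _)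
    calc p i * y ^ i - p i * x ^ i = p i * (y ^ i - x ^ i) := by ring
      _ ≤ p i * (i * y ^ (i - 1) * (y - x)) :=
        mul_le_mul_of_nonneg_left (pow_sub_pow_le_mul_pow_pred_mul_sub hx.1 hxy i) (hp i)
      _ = (i : ℝ) * p i * y ^ (i - 1) * (y - x) := by ring

end GeneratingFunction

/-- For a critical offspring distribution with finite nonzero second
factorial moment, the peel-number distribution `(r i)` (satisfying the recurrences
derived in the paper) satisfies `r i > 0` and `r i = f'(1-q)^{i+o(i)}`, i.e.
`(r i)^{1/i} → f'(1-q)`. -/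
theorem peel_number_distribution_root_asymptotics
    (p : ℕ → ℝ) (hp : ∀ i, 0 ≤ p i) (hsum : ∑' i, p i = 1)
    (hp0 : p 0 ∈ Set.Ioo (0 : ℝ) 1)
    (hmean_summable : Summable (fun i : ℕ => (i : ℝ) * p i))
    (hmean : ∑' i : ℕ, (i : ℝ) * p i = 1)
    (hvar_summable : Summable (fun i : ℕ => (i : ℝ) * ((i : ℝ) - 1) * p i))
    (hvar_pos : 0 < ∑' i : ℕ, (i : ℝ) * ((i : ℝ) - 1) * p i)
    (f : ℝ → ℝ) (hf : ∀ s ∈ Set.Icc (0 : ℝ) 1, f s = ∑' i, p i * s ^ i)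
    (f' : ℝ → ℝ)
    (hf' : ∀ s ∈ Set.Icc (0 : ℝ) 1, f' s = ∑' i : ℕ, (i : ℝ) * p i * s ^ (i - 1))
    (q : ℝ) (hq : q ∈ Set.Ioo (1 / 2 : ℝ) 1) (hqfix : q = f (1 - q))
    (r : ℕ → ℝ) (hr : ∀ i, 0 ≤ r i)
    (hr0 : r 0 = p 0)
    (hreven_sum : ∑' i : ℕ, r (2 * i) = q)
    (hrodd_sum : ∑' i : ℕ, r (2 * i + 1) = 1 - q)
    (hreven : ∀ i : ℕ, 1 ≤ i →
      r (2 * i) = f (∑ k ∈ Finset.range i, r (2 * k + 1)) -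
        f (∑ k ∈ Finset.range (i - 1), r (2 * k + 1)))
    (hrodd : ∀ i : ℕ, 1 ≤ i →
      r (2 * i - 1) = f (1 - q + ∑' k : ℕ, r (2 * (k + (i - 1)))) -
        f (1 - q + ∑' k : ℕ, r (2 * (k + i)))) :
    (∀ i, 0 < r i) ∧
      Tendsto (fun i : ℕ => r i ^ (1 / (i : ℝ))) atTop (nhds (f' (1 - q))) := by
  have hps : Summable p := by
    by_contra h
    simp [tsum_eq_zero_of_not_summable h] at hsum
  have hes : Summable fun i => r (2 * i) := by
    by_contra h
    have := tsum_eq_zero_of_not_summable h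
    linarith [hq.1]
  have hos : Summable fun i => r (2 * i + 1) := by
    by_contra h
    have := tsum_eq_zero_of_not_summable h
    linarith [hq.2]
  have hp' : ∀ i : ℕ, 0 ≤ (i : ℝ) * p i := fun i => mul_nonneg i.cast_nonneg (hp i)
  obtain ⟨m, hm, hpm⟩ : ∃ m : ℕ, m ≠ 0 ∧ 0 < p m := by
    by_contra! h
    have h0 : ∀ i : ℕ, (i : ℝ) * p i = 0 := fun i => by
      rcases eq_or_ne i 0 with rfl | hi
      · simp
      · rw [le_antisymm (h i hi) (hp i), mul_zero]
    simp [h0] at hmean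
  have hmono : StrictMonoOn f (Set.Icc 0 1) :=
    (strictMonoOn_tsum_mul_pow hp hps hm hpm).congr fun s hs => (hf s hs).symm
  have hcont : ContinuousOn f' (Set.Icc 0 1) :=
    (continuousOn_tsum_mul_pow hp' hmean_summable fun i => i - 1).congr hf'
  have hslope : ∀ x ∈ Set.Icc (0 : ℝ) 1, ∀ y ∈ Set.Icc (0 : ℝ) 1, x ≤ y →
      f y - f x ∈ Set.Icc (f' x * (y - x)) (f' y * (y - x)) := fun x hx y hy hxy => by
    rw [hf x hx, hf y hy, hf' x hx, hf' y hy]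
    exact tsum_mul_pow_sub_mem_Icc hp hps hmean_summable hx hy hxy
  have hq' : 1 - q ∈ Set.Icc (0 : ℝ) 1 := ⟨by linarith [hq.2], by linarith [hq.1]⟩
  have hL : 0 < f' (1 - q) := by
    rw [hf' _ hq']
    refine (summable_mul_pow_of_mem_Icc hp' hmean_summable hq' fun i => i - 1).tsum_pos
      (fun i => mul_nonneg (hp' i) (pow_nonneg hq'.1 _)) m ?_
    have : 0 < 1 - q := by linarith [hq.2]
    positivity
  set O : ℕ → ℝ := fun i => ∑ k ∈ Finset.range i, r (2 * k + 1) with hO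
  set T : ℕ → ℝ := fun i => 1 - q + ∑' k : ℕ, r (2 * (k + i)) with hT
  have hOsucc : ∀ i, O (i + 1) - O i = r (2 * i + 1) := fun i => by
    simp [hO, Finset.sum_range_succ]
  have hTsucc : ∀ i, T i - T (i + 1) = r (2 * i) := fun i => by
    have h := ((summable_nat_add_iff i).2 hes).tsum_eq_zero_add
    simp only [hT, h, zero_add, add_assoc, add_comm 1 i]
    ring
  have hOlim : Tendsto O atTop (nhds (1 - q)) := hrodd_sum ▸ hos.hasSum.tendsto_sum_nat
  have hTlim : Tendsto T atTop (nhds (1 - q)) := by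
    simpa [hT] using (tendsto_sum_nat_add fun i => r (2 * i)).const_add (1 - q)
  have hOmem : ∀ i, O i ∈ Set.Icc (0 : ℝ) 1 := fun i =>
    ⟨Finset.sum_nonneg fun k _ => hr _,
      ((hos.sum_le_tsum _ fun k _ => hr _).trans hrodd_sum.le).trans hq'.2⟩
  have hTanti : Antitone T := antitone_nat_of_succ_le fun i => by linarith [hTsucc i, hr (2 * i)]
  have hTmem : ∀ i, T i ∈ Set.Icc (0 : ℝ) 1 := fun i => by
    refine ⟨add_nonneg hq'.1 (tsum_nonneg fun k => hr _), (hTanti i.zero_le).trans ?_⟩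
    simp [hT, hreven_sum]
  have hE : ∀ i, r (2 * i + 2) = f (O (i + 1)) - f (O i) := fun i => hreven (i + 1) (by omega)
  have hD : ∀ i, r (2 * i + 1) = f (T i) - f (T (i + 1)) := fun i => hrodd (i + 1) (by omega)
  have hodd_pos : ∀ i, 0 < r (2 * i) → 0 < r (2 * i + 1) := fun i hi => by
    rw [hD, sub_pos]
    exact hmono (hTmem _) (hTmem _) (by linarith [hTsucc i])
  have heven_pos : ∀ i, 0 < r (2 * i) := fun i => by
    induction i with
    | zero => simpa [hr0] using hp0.1
    | succ i ih =>
      rw [mul_add, mul_one, hE, sub_pos]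
      exact hmono (hOmem _) (hOmem _) (by linarith [hOsucc i, hodd_pos i ih])
  have hpos : ∀ i, 0 < r i := fun i => by
    obtain ⟨k, rfl | rfl⟩ := Nat.even_or_odd' i
    exacts [heven_pos k, hodd_pos k (heven_pos k)]
  have hcomp : ∀ u : ℕ → ℝ, (∀ i, u i ∈ Set.Icc (0 : ℝ) 1) → Tendsto u atTop (nhds (1 - q)) →
      Tendsto (fun i => f' (u i)) atTop (nhds (f' (1 - q))) := fun u hu hlim =>
    (hcont _ hq').tendsto.comp
      (tendsto_nhdsWithin_iff.2 ⟨hlim, Eventually.of_forall hu⟩)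
  refine ⟨hpos, tendsto_rpow_one_div_of_tendsto_div hpos hL (tendsto_atTop_of_even_of_odd ?_ ?_)⟩
  · have hT' := hcomp T hTmem hTlim
    refine tendsto_of_tendsto_of_tendsto_of_le_of_le ((tendsto_add_atTop_iff_nat 1).2 hT') hT'
      (fun i => ?_) (fun i => ?_)
    all_goals
      have h := hslope _ (hTmem (i + 1)) _ (hTmem i) (hTanti i.le_succ)
      rw [hTsucc, ← hD] at h
    exacts [(le_div_iff₀ (hpos _)).2 h.1, (div_le_iff₀ (hpos _)).2 h.2]
  · have hO' := hcomp O hOmem hOlim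
    refine tendsto_of_tendsto_of_tendsto_of_le_of_le hO' ((tendsto_add_atTop_iff_nat 1).2 hO')
      (fun i => ?_) (fun i => ?_)
    all_goals
      have h := hslope _ (hOmem i) _ (hOmem (i + 1)) (by linarith [hOsucc i, hr (2 * i + 1)])
      rw [hOsucc, ← hE] at h
    exacts [(le_div_iff₀ (hpos _)).2 h.1, (div_le_iff₀ (hpos _)).2 h.2]
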